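/- Let n ≥ 1. For any two negative vectors v, w ∈ V (i.e., B(v,v) < 0 and B(w,w) < 0), there exists a negative vector u ∈ V such that every point of the straight segments from v to u and from u to w is a negative vector: B((1−s)v + su, (1−s)v + su) < 0 and B((1−s)u + sw, (1−s)u + sw) < 0 for all s ∈ [0,1]. -/

import Mathlib

/-- The bilinear form of signature (n,2) on ℝ^(n+2): first two coordinates negative. -/
noncomputable def B (n : ℕ) (x y : Fin (n + 2) → ℝ) : ℝ :=
  ∑ i : Fin (n + 2), (if (i : ℕ) < 2 then -1 else 1) * (x i * y i)

/-- w(x;𝒞) = ∑_j sgn(B(x,C_j)) sgn(B(x,C_{j+1})), with cyclic indexing. -/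
noncomputable def wt (n N : ℕ) [NeZero N] (C : Fin N → (Fin (n + 2) → ℝ))
    (x : Fin (n + 2) → ℝ) : ℝ :=
  ∑ j : Fin N, Real.sign (B n x (C j)) * Real.sign (B n x (C (j + 1)))

/-- Incidence condition (I.1). -/
def I1 (n N : ℕ) (C : Fin N → (Fin (n + 2) → ℝ)) : Prop :=
  ∀ j, B n (C j) (C j) ≤ 0

/-- Incidence condition (I.2). -/
def I2 (n N : ℕ) [NeZero N] (C : Fin N → (Fin (n + 2) → ℝ)) : Prop :=
  ∀ j : Fin N,
    (B n (C j) (C j) * B n (C (j + 1)) (C (j + 1)) > 0 →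
      B n (C j) (C j) * B n (C (j + 1)) (C (j + 1)) - (B n (C j) (C (j + 1))) ^ 2 > 0) ∧
    (B n (C j) (C j) * B n (C (j + 1)) (C (j + 1)) = 0 →
      B n (C j) (C j) * B n (C (j + 1)) (C (j + 1)) - (B n (C j) (C (j + 1))) ^ 2 = 0)

/-- Incidence condition (I.3). -/
def I3 (n N : ℕ) [NeZero N] (C : Fin N → (Fin (n + 2) → ℝ)) : Prop :=
  ∀ j : Fin N,
    (B n (C j) (C j) < 0 →
      B n (C j) (C j) * B n (C (j - 1)) (C (j + 1)) -
        B n (C j) (C (j - 1)) * B n (C j) (C (j + 1)) < 0) ∧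
    (B n (C j) (C j) = 0 → B n (C (j - 1)) (C (j + 1)) > 0)

/-- The form `B` with its two negative coordinates split off. -/
theorem B_eq_neg_add_sum (n : ℕ) (x y : Fin (n + 2) → ℝ) :
    B n x y = -(x 0 * y 0) - x 1 * y 1 + ∑ i : Fin n, x i.succ.succ * y i.succ.succ := by
  simp only [B, Fin.sum_univ_succ]
  simp
  ring

theorem B_comm (n : ℕ) (x y : Fin (n + 2) → ℝ) : B n x y = B n y x := by
  simp only [B, mul_comm (x _)]

theorem B_smul_add_smul_self (n : ℕ) (x y : Fin (n + 2) → ℝ) (a b : ℝ) :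
    B n (a • x + b • y) (a • x + b • y) =
      a ^ 2 * B n x x + 2 * (a * b) * B n x y + b ^ 2 * B n y y := by
  simp only [B, Finset.mul_sum, ← Finset.sum_add_distrib]
  refine Finset.sum_congr rfl fun i _ => ?_
  simp only [Pi.add_apply, Pi.smul_apply, smul_eq_mul]
  ring

/-- The segment between two negative vectors with nonpositive pairing is negative. -/
theorem B_segment_neg {n : ℕ} {x y : Fin (n + 2) → ℝ} (hx : B n x x < 0) (hy : B n y y < 0)
    (hxy : B n x y ≤ 0) {s : ℝ} (hs : s ∈ Set.Icc (0 : ℝ) 1) :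
    B n ((1 - s) • x + s • y) ((1 - s) • x + s • y) < 0 := by
  obtain ⟨hs0, hs1⟩ := hs
  rw [B_smul_add_smul_self]
  have hcross : 2 * ((1 - s) * s) * B n x y ≤ 0 :=
    mul_nonpos_of_nonneg_of_nonpos
      (mul_nonneg zero_le_two (mul_nonneg (sub_nonneg.2 hs1) hs0)) hxy
  rcases hs0.eq_or_lt with rfl | hpos
  · simpa using hx
  · have hx' : (1 - s) ^ 2 * B n x x ≤ 0 :=
      mul_nonpos_of_nonneg_of_nonpos (sq_nonneg _) hx.le
    have hy' : s ^ 2 * B n y y < 0 := mul_neg_of_pos_of_neg (pow_pos hpos 2) hy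
    linarith

/-- A negative vector has nonzero projection to the negative definite plane. -/
theorem sq_add_sq_pos_of_B_neg {n : ℕ} {v : Fin (n + 2) → ℝ} (hv : B n v v < 0) :
    0 < v 0 ^ 2 + v 1 ^ 2 := by
  rw [B_eq_neg_add_sum] at hv
  have := Finset.sum_nonneg fun (i : Fin n) (_ : i ∈ Finset.univ) =>
    mul_self_nonneg (v i.succ.succ)
  linarith

/-- For negative `v` and arbitrary `w`, a negative vector orthogonal to `v` pairs nonpositively
with `w` after a choice of sign. -/
theorem exists_B_neg_of_B_neg {n : ℕ} {v : Fin (n + 2) → ℝ} (hv : B n v v < 0)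
    (w : Fin (n + 2) → ℝ) : ∃ u, B n u u < 0 ∧ B n v u = 0 ∧ B n u w ≤ 0 := by
  obtain ⟨c, hc, hcw⟩ : ∃ c : ℝ, c ^ 2 = 1 ∧ 0 ≤ c * (v 0 * w 1 - v 1 * w 0) := by
    rcases le_total 0 (v 0 * w 1 - v 1 * w 0) with h | h
    · exact ⟨1, by norm_num, by linarith⟩
    · exact ⟨-1, by norm_num, by linarith⟩
  have hpair (y : Fin (n + 2) → ℝ) :
      B n (Fin.cons (-(c * v 1)) (Fin.cons (c * v 0) 0)) y = -(c * (v 0 * y 1 - v 1 * y 0)) := by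
    have h1 : (1 : Fin (n + 2)) = Fin.succ 0 := rfl
    rw [B_eq_neg_add_sum, h1]
    simp only [Fin.cons_zero, Fin.cons_succ, Pi.zero_apply, zero_mul, Finset.sum_const_zero]
    ring
  refine ⟨Fin.cons (-(c * v 1)) (Fin.cons (c * v 0) 0), ?_, ?_, ?_⟩
  · have h1 : (1 : Fin (n + 2)) = Fin.succ 0 := rfl
    have hpos := sq_add_sq_pos_of_B_neg hv
    rw [hpair, h1]
    simp only [Fin.cons_zero, Fin.cons_succ]
    rw [← h1]
    linear_combination hpos - (v 0 ^ 2 + v 1 ^ 2) * hc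
  · rw [B_comm, hpair]
    ring
  · rw [hpair]
    linarith

/-- any two negative vectors can be joined by two segments through a
third negative vector, staying inside the negative cone. -/
theorem negative_vectors_connected_by_two_segments (n : ℕ) (hn : 1 ≤ n)
    (v w : Fin (n + 2) → ℝ) (hv : B n v v < 0) (hw : B n w w < 0) :
    ∃ u : Fin (n + 2) → ℝ, B n u u < 0 ∧
      (∀ s ∈ Set.Icc (0 : ℝ) 1,
        B n ((1 - s) • v + s • u) ((1 - s) • v + s • u) < 0) ∧
      (∀ s ∈ Set.Icc (0 : ℝ) 1,
        B n ((1 - s) • u + s • w) ((1 - s) • u + s • w) < 0) := by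
  obtain ⟨u, hu, hvu, huw⟩ := exists_B_neg_of_B_neg hv w
  exact ⟨u, hu, fun _ hs => B_segment_neg hv hu hvu.le hs, fun _ hs => B_segment_neg hu hw huw hs⟩
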